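/- arXiv:2106.08916 — 2 statements merged into one kernel-verified Lean document; each statement's English description precedes it below -/
import Mathlib

section
/- Assume g > 0, Δ > 0 and Δ² + 4g² = 2, and set μ = √(8g² + Δ²) > 0. Then the parity solutions Π± := μ·Ψ ± J₁Ψ are nonzero and satisfy J₁Π± = ±μ·Π±; that is, the two-dimensional degenerate eigenspace for the Juddian eigenvalue 3/2 − g² decomposes into one-dimensional eigenspaces of J₁ with eigenvalues μ and −μ. -/
open Complex

/-- The hidden symmetry operator `J₁` in the Bargmann picture. -/
noncomputable def J1 (g Δ : ℝ) (F : (ℂ → ℂ) × (ℂ → ℂ)) : (ℂ → ℂ) × (ℂ → ℂ) :=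
  (fun z => (Δ : ℂ) * F.1 (-z) + 2 * (g : ℂ) * ((g : ℂ) * F.2 (-z) - deriv F.2 (-z)),
   fun z => 2 * (g : ℂ) * ((g : ℂ) - z) * F.1 (-z) + (Δ : ℂ) * F.2 (-z))

/-- The Juddian eigenfunction `Ψ = (ψ₁, ψ₂)` for `ℓ = 1`, `N = 1`. -/
noncomputable def Psi (g Δ : ℝ) : (ℂ → ℂ) × (ℂ → ℂ) :=
  (fun z => Complex.exp (-((g : ℂ) * z)) * (z + (1 - (g : ℂ) ^ 2) / (g : ℂ)),
   fun z => Complex.exp (-((g : ℂ) * z)) * ((Δ : ℂ) / (2 * (g : ℂ))))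

theorem J1_lincomb (g Δ : ℝ) (a b : ℂ) {F G : (ℂ → ℂ) × (ℂ → ℂ)}
    (hF : Differentiable ℂ F.2) (hG : Differentiable ℂ G.2) :
    J1 g Δ (a • F + b • G) = a • J1 g Δ F + b • J1 g Δ G := by
  have hd (z : ℂ) : deriv (a • F.2 + b • G.2) z = a * deriv F.2 z + b * deriv G.2 z :=
    (((hF z).hasDerivAt.const_smul a).add ((hG z).hasDerivAt.const_smul b)).deriv
  ext z
  · simp only [J1, Prod.fst_add, Prod.snd_add, Prod.smul_fst, Prod.smul_snd, hd, Pi.add_apply,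
      Pi.smul_apply, smul_eq_mul]
    ring
  · simp only [J1, Prod.fst_add, Prod.snd_add, Prod.smul_fst, Prod.smul_snd, Pi.add_apply,
      Pi.smul_apply, smul_eq_mul]
    ring

theorem differentiable_Psi_snd (g Δ : ℝ) : Differentiable ℂ (Psi g Δ).2 := by
  unfold Psi
  fun_prop

theorem deriv_Psi_snd (g Δ : ℝ) (z : ℂ) : deriv (Psi g Δ).2 z = -g * (Psi g Δ).2 z := by
  have h : HasDerivAt (fun z : ℂ => exp (-((g : ℂ) * z)) * ((Δ : ℂ) / (2 * (g : ℂ))))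
      (exp (-((g : ℂ) * z)) * -((g : ℂ) * 1) * ((Δ : ℂ) / (2 * (g : ℂ)))) z :=
    (((hasDerivAt_id z).const_mul (g : ℂ)).neg.cexp).mul_const _
  change deriv (fun z : ℂ => exp (-((g : ℂ) * z)) * ((Δ : ℂ) / (2 * (g : ℂ)))) z = _
  rw [h.deriv, Psi]
  ring

theorem J1_Psi {g Δ : ℝ} (hg : g ≠ 0) (hc : Δ ^ 2 + 4 * g ^ 2 = 2) :
    J1 g Δ (Psi g Δ) =
      (fun z => exp (g * z) * (Δ * (-z + (1 + (g : ℂ) ^ 2) / g)),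
       fun z => exp (g * z) * (2 * g * z ^ 2 - 2 * z + 1 / g - 2 * (g : ℂ) ^ 3)) := by
  have hg' : (g : ℂ) ≠ 0 := ofReal_ne_zero.mpr hg
  have hc' : (Δ : ℂ) ^ 2 + 4 * (g : ℂ) ^ 2 = 2 := by exact_mod_cast hc
  ext z
  · simp only [J1, deriv_Psi_snd]
    simp only [Psi, mul_neg, neg_neg]
    field_simp
    ring
  · simp only [J1, Psi, mul_neg, neg_neg]
    field_simp
    linear_combination hc'

theorem differentiable_J1_Psi_snd {g Δ : ℝ} (hg : g ≠ 0) (hc : Δ ^ 2 + 4 * g ^ 2 = 2) :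
    Differentiable ℂ (J1 g Δ (Psi g Δ)).2 := by
  rw [J1_Psi hg hc]
  fun_prop

theorem J1_J1_Psi {g Δ : ℝ} (hg : g ≠ 0) (hc : Δ ^ 2 + 4 * g ^ 2 = 2) :
    J1 g Δ (J1 g Δ (Psi g Δ)) = (8 * (g : ℂ) ^ 2 + (Δ : ℂ) ^ 2) • Psi g Δ := by
  have hg' : (g : ℂ) ≠ 0 := ofReal_ne_zero.mpr hg
  have hc' : (Δ : ℂ) ^ 2 = 2 - 4 * (g : ℂ) ^ 2 := by
    rw [eq_sub_iff_add_eq]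
    exact_mod_cast hc
  have hd (z : ℂ) : deriv (fun z : ℂ =>
      exp (g * z) * (2 * g * z ^ 2 - 2 * z + 1 / g - 2 * (g : ℂ) ^ 3)) z =
      exp (g * z) * (g * (2 * g * z ^ 2 - 2 * z + 1 / g - 2 * (g : ℂ) ^ 3) + (4 * g * z - 2)) := by
    have he := ((hasDerivAt_id z).const_mul (g : ℂ)).cexp
    have hp := (((((hasDerivAt_id z).pow 2).const_mul (2 * (g : ℂ))).sub
      ((hasDerivAt_id z).const_mul 2)).add_const (1 / (g : ℂ))).sub_const (2 * (g : ℂ) ^ 3)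
    refine (he.mul hp).deriv.trans ?_
    simp
    ring
  rw [J1_Psi hg hc]
  ext z
  · simp only [J1, hd, Psi, Prod.smul_fst, Pi.smul_apply, smul_eq_mul, mul_neg, neg_neg]
    field_simp
    ring_nf
    simp only [hc']
    ring
  · simp only [J1, Psi, Prod.smul_snd, Pi.smul_apply, smul_eq_mul, mul_neg, neg_neg]
    field_simp
    ring_nf
    simp only [show (Δ : ℂ) ^ 3 = Δ * Δ ^ 2 by ring, hc']
    ring

theorem smul_Psi_add_smul_J1_Psi_ne_zero {g Δ : ℝ} (hg : g ≠ 0) (hc : Δ ^ 2 + 4 * g ^ 2 = 2)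
    {a : ℂ} (ha : a ≠ 0) (b : ℂ) : a • Psi g Δ + b • J1 g Δ (Psi g Δ) ≠ 0 := by
  have hg' : (g : ℂ) ≠ 0 := ofReal_ne_zero.mpr hg
  intro h
  have h1 := congrFun (congrArg Prod.fst h) ((1 + (g : ℂ) ^ 2) / g)
  rw [J1_Psi hg hc] at h1
  have h2 : (1 + (g : ℂ) ^ 2) / g + (1 - (g : ℂ) ^ 2) / g = 2 / g := by ring
  simp [Psi, h2, ha, hg', exp_ne_zero] at h1

theorem J1_smul_Psi_add_smul_J1_Psi {g Δ : ℝ} (hg : g ≠ 0) (hc : Δ ^ 2 + 4 * g ^ 2 = 2) (a b : ℂ) :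
    J1 g Δ (a • Psi g Δ + b • J1 g Δ (Psi g Δ)) =
      a • J1 g Δ (Psi g Δ) + (b * (8 * (g : ℂ) ^ 2 + (Δ : ℂ) ^ 2)) • Psi g Δ := by
  rw [J1_lincomb g Δ a b (differentiable_Psi_snd g Δ) (differentiable_J1_Psi_snd hg hc),
    J1_J1_Psi hg hc, smul_smul]

/-- Under the constraint `Δ² + 4g² = 2`, with `μ = √(8g² + Δ²) > 0`, the parity
solutions `Π± = μΨ ± J₁Ψ` are nonzero eigenfunctions of `J₁` with eigenvalues `±μ`. -/
theorem stmt3 (g Δ : ℝ) (hg : 0 < g) (hΔ : 0 < Δ) (hc : Δ ^ 2 + 4 * g ^ 2 = 2)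
    (μ : ℝ) (hμ : μ = Real.sqrt (8 * g ^ 2 + Δ ^ 2)) :
    0 < μ ∧
    (μ : ℂ) • Psi g Δ + J1 g Δ (Psi g Δ) ≠ 0 ∧
    (μ : ℂ) • Psi g Δ - J1 g Δ (Psi g Δ) ≠ 0 ∧
    J1 g Δ ((μ : ℂ) • Psi g Δ + J1 g Δ (Psi g Δ))
      = (μ : ℂ) • ((μ : ℂ) • Psi g Δ + J1 g Δ (Psi g Δ)) ∧
    J1 g Δ ((μ : ℂ) • Psi g Δ - J1 g Δ (Psi g Δ))
      = (-(μ : ℂ)) • ((μ : ℂ) • Psi g Δ - J1 g Δ (Psi g Δ)) := by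
  have hμ0 : 0 < μ := hμ ▸ Real.sqrt_pos.mpr (by positivity)
  have hμ' : (μ : ℂ) ≠ 0 := ofReal_ne_zero.mpr hμ0.ne'
  have hsq : 8 * (g : ℂ) ^ 2 + (Δ : ℂ) ^ 2 = (μ : ℂ) ^ 2 := by
    have : 8 * g ^ 2 + Δ ^ 2 = μ ^ 2 := by rw [hμ, Real.sq_sqrt (by positivity)]
    exact_mod_cast this
  have hadd : (μ : ℂ) • Psi g Δ + J1 g Δ (Psi g Δ) =
      (μ : ℂ) • Psi g Δ + (1 : ℂ) • J1 g Δ (Psi g Δ) := by rw [one_smul]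
  have hsub : (μ : ℂ) • Psi g Δ - J1 g Δ (Psi g Δ) =
      (μ : ℂ) • Psi g Δ + (-1 : ℂ) • J1 g Δ (Psi g Δ) := by rw [neg_one_smul, sub_eq_add_neg]
  rw [hadd, hsub]
  refine ⟨hμ0, smul_Psi_add_smul_J1_Psi_ne_zero hg.ne' hc hμ' 1,
    smul_Psi_add_smul_J1_Psi_ne_zero hg.ne' hc hμ' (-1), ?_, ?_⟩ <;>
  · rw [J1_smul_Psi_add_smul_J1_Psi hg.ne' hc, hsq]
    module
end

section
/- For every ℓ ∈ ℕ and all real g, x: det M_ℓ(x, g) = (2g)^{2ℓ} · ∏_{i=1}^{ℓ} (x − ℓ/2 + g² + i), i.e. det M_ℓ(x, g) equals (2g)^{2ℓ} times the Pochhammer product (x − ℓ/2 + 1 + g²)_ℓ. (This is the value p_ℓ(x; g, 0) of the symmetry polynomial at Δ = 0.) -/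
/-- The `ℓ×ℓ` tridiagonal matrix `M_ℓ(x, g)` (rows and columns indexed by `Fin ℓ`,
corresponding to the 1-based index `i = ↑i + 1`). -/
noncomputable def Mmat (ℓ : ℕ) (x g : ℝ) : Matrix (Fin ℓ) (Fin ℓ) ℝ :=
  Matrix.of fun i j =>
    if (i : ℕ) = (j : ℕ) then
      ((2 * g) ^ 2 - (ℓ : ℝ) + 2 * (((i : ℕ) : ℝ) + 1) - 1)
        * (x - (ℓ : ℝ) / 2 + g ^ 2 + (((i : ℕ) : ℝ) + 1))
    else if (j : ℕ) = (i : ℕ) + 1 then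
      x - (ℓ : ℝ) / 2 + g ^ 2 + (((i : ℕ) : ℝ) + 1)
    else if (i : ℕ) = (j : ℕ) + 1 then
      -((((j : ℕ) : ℝ) + 1) * ((ℓ : ℝ) - (((j : ℕ) : ℝ) + 1)))
        * (x - (ℓ : ℝ) / 2 + g ^ 2 + (((j : ℕ) : ℝ) + 1) + 1)
    else 0

/-- The tridiagonal matrix with diagonal `a`, superdiagonal `b` and subdiagonal `c`. -/
def tridiagonal {R : Type*} [Zero R] (a b c : ℕ → R) (n : ℕ) : Matrix (Fin n) (Fin n) R :=
  Matrix.of fun i j =>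
    if (i : ℕ) = j then a i
    else if (j : ℕ) = i + 1 then b i
    else if (i : ℕ) = j + 1 then c j
    else 0

theorem det_tridiagonal_add_two {R : Type*} [CommRing R] (a b c : ℕ → R) (n : ℕ) :
    (tridiagonal a b c (n + 2)).det =
      a 0 * (tridiagonal (fun i => a (i + 1)) (fun i => b (i + 1)) (fun i => c (i + 1))
        (n + 1)).det
      - b 0 * c 0 * (tridiagonal (fun i => a (i + 2)) (fun i => b (i + 2)) (fun i => c (i + 2))
        n).det := by
  have h₁ : (tridiagonal a b c (n + 2)).submatrix Fin.succ (Fin.succAbove 0) =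
      tridiagonal (fun i => a (i + 1)) (fun i => b (i + 1)) (fun i => c (i + 1)) (n + 1) := by
    ext i j
    simp [tridiagonal]
  have h₂ : ((tridiagonal a b c (n + 2)).submatrix Fin.succ (Fin.succAbove 1)).det =
      c 0 * (tridiagonal (fun i => a (i + 2)) (fun i => b (i + 2)) (fun i => c (i + 2)) n).det := by
    rw [Matrix.det_succ_column_zero, Fin.sum_univ_succ, Finset.sum_eq_zero]
    · have h : ((tridiagonal a b c (n + 2)).submatrix Fin.succ (Fin.succAbove 1)).submatrix
          (Fin.succAbove 0) Fin.succ =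
          tridiagonal (fun i => a (i + 2)) (fun i => b (i + 2)) (fun i => c (i + 2)) n := by
        ext i j
        simp [tridiagonal, Fin.succAbove, Fin.lt_def]
      rw [h]
      simp [tridiagonal]
    · intro i _
      simp [tridiagonal]
  rw [Matrix.det_succ_row_zero, Fin.sum_univ_succ, Fin.sum_univ_succ, Finset.sum_eq_zero]
  · rw [h₁, Fin.succ_zero_eq_one, h₂]
    simp [tridiagonal]
    ring
  · intro i _
    simp [tridiagonal]

/-- The polynomials `∑ j, k.choose j * t ^ (k - j) * (m)_j`, where `(m)_j` is the rising
factorial, given by their recursion in `k`. -/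
def risingBinomialSum {R : Type*} [CommRing R] (t : R) : ℕ → R → R
  | 0, _ => 1
  | k + 1, m => t * risingBinomialSum t k m + m * risingBinomialSum t k (m + 1)

section risingBinomialSum

variable {R : Type*} [CommRing R] (t : R)

theorem risingBinomialSum_zero_right (k : ℕ) : risingBinomialSum t k 0 = t ^ k := by
  induction k with
  | zero => simp [risingBinomialSum]
  | succ k ih => simp [risingBinomialSum, ih, pow_succ']

theorem risingBinomialSum_succ_sub (k : ℕ) (m : R) :
    risingBinomialSum t (k + 1) m =
      risingBinomialSum t (k + 1) (m + 1) - (k + 1) * risingBinomialSum t k (m + 1) := by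
  induction k generalizing m with
  | zero =>
    simp [risingBinomialSum]
    ring
  | succ k ih =>
    have h₁ := ih m
    have h₂ := ih (m + 1)
    have h (l : ℕ) (y : R) : risingBinomialSum t (l + 1) y =
      t * risingBinomialSum t l y + y * risingBinomialSum t l (y + 1) := rfl
    have h₃ := h k (m + 1)
    rw [h (k + 1) m, h (k + 1) (m + 1)]
    push_cast
    linear_combination t * h₁ + (m + 1) * h₂ + (k + 1) * h₃

theorem risingBinomialSum_add_two (k : ℕ) (m : R) :
    risingBinomialSum t (k + 2) m =
      (t + m - k - 1) * risingBinomialSum t (k + 1) (m + 1)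
        + (m + 1) * (k + 1) * risingBinomialSum t k (m + 2) := by
  have h₁ := risingBinomialSum_succ_sub t k m
  have h₂ : risingBinomialSum t (k + 1) (m + 1) = t * risingBinomialSum t k (m + 1)
      + (m + 1) * risingBinomialSum t k (m + 1 + 1) := rfl
  rw [add_assoc m, one_add_one_eq_two] at h₂
  rw [risingBinomialSum]
  linear_combination t * h₁ + (k + 1) * h₂

/-- With `m = ℓ - k`, these are the trailing `k × k` minors of the `ℓ × ℓ` matrix with
diagonal `t - ℓ + 2 i - 1`, superdiagonal `1` and subdiagonal `- i (ℓ - i)`. -/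
theorem det_tridiagonal_eq_risingBinomialSum (k : ℕ) (m : R) :
    (tridiagonal (fun i => t + m - k + 2 * i + 1) (fun _ => 1)
      (fun i => -((m + i + 1) * (k - i - 1))) k).det = risingBinomialSum t k m := by
  induction k using Nat.twoStepInduction generalizing m with
  | zero => simp [risingBinomialSum]
  | one => simp [risingBinomialSum, tridiagonal]
  | more k ih₀ ih₁ =>
    rw [det_tridiagonal_add_two, risingBinomialSum_add_two, ← ih₀, ← ih₁]
    have e (a a' c c' : ℕ → R) (n : ℕ) (ha : a = a') (hc : c = c') :
        (tridiagonal a (fun _ => 1) c n).det = (tridiagonal a' (fun _ => 1) c' n).det := by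
      rw [ha, hc]
    rw [e _ (fun i => t + (m + 1) - (k + 1 : ℕ) + 2 * i + 1) _
        (fun i => -((m + 1 + i + 1) * ((k + 1 : ℕ) - i - 1))) (k + 1)
        (by ext i; push_cast; ring) (by ext i; push_cast; ring),
      e _ (fun i => t + (m + 2) - k + 2 * i + 1) _
        (fun i => -((m + 2 + i + 1) * (k - i - 1))) k
        (by ext i; push_cast; ring) (by ext i; push_cast; ring)]
    push_cast
    ring

end risingBinomialSum

theorem Mmat_eq_diagonal_mul_tridiagonal (ℓ : ℕ) (x g : ℝ) :
    Mmat ℓ x g =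
      Matrix.diagonal (fun i : Fin ℓ => x - (ℓ : ℝ) / 2 + g ^ 2 + ((i : ℝ) + 1)) *
        tridiagonal (fun i => (2 * g) ^ 2 + 0 - (ℓ : ℝ) + 2 * i + 1) (fun _ => 1)
          (fun i => -((0 + (i : ℝ) + 1) * (ℓ - i - 1))) ℓ := by
  ext i j
  rw [Matrix.diagonal_mul]
  simp only [Mmat, tridiagonal, Matrix.of_apply]
  split_ifs with h₁ h₂ h₃
  · ring
  · ring
  · rw [h₃]
    push_cast
    ring
  · ring

/-- `det M_ℓ(x, g) = (2g)^{2ℓ} · ∏_{i=1}^{ℓ} (x − ℓ/2 + g² + i)`, i.e. the value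
`p_ℓ(x; g, 0)` of the symmetry polynomial at `Δ = 0` is `(2g)^{2ℓ}` times the
Pochhammer product `(x − ℓ/2 + 1 + g²)_ℓ`. -/
theorem stmt11 (ℓ : ℕ) (g x : ℝ) :
    (Mmat ℓ x g).det
      = (2 * g) ^ (2 * ℓ)
        * ∏ i ∈ Finset.range ℓ, (x - (ℓ : ℝ) / 2 + g ^ 2 + ((i : ℝ) + 1)) := by
  rw [Mmat_eq_diagonal_mul_tridiagonal, Matrix.det_mul, Matrix.det_diagonal,
    det_tridiagonal_eq_risingBinomialSum, risingBinomialSum_zero_right, ← pow_mul,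
    Fin.prod_univ_eq_prod_range (fun i : ℕ => x - (ℓ : ℝ) / 2 + g ^ 2 + ((i : ℝ) + 1)), mul_comm]
end
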